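/- A weakly compact cardinal κ is ω-weakly compact if and only if for every n < ω the set S^κ_n is a weakly compact subset of κ, where S^κ_0 is the set of Mahlo cardinals below κ and, for 0 < n, S^κ_n is the set of n-weakly compact cardinals below κ. -/

import Mathlib

open FirstOrder FirstOrder.Language ZFSet
open scoped Classical

noncomputable section

def memLang : Language where
  Functions := fun _ => Empty
  Relations := fun n => match n with | 2 => Unit | _ => Empty

def memRel : memLang.Relations 2 := Unit.unit

def mem' (n : ℕ) (i j : Fin n) : memLang.BoundedFormula Empty n :=
  Relations.boundedFormula₂ memRel (Term.var (Sum.inr i)) (Term.var (Sum.inr j))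

def eq' (n : ℕ) (i j : Fin n) : memLang.BoundedFormula Empty n :=
  Term.bdEqual (Term.var (Sum.inr i)) (Term.var (Sum.inr j))

def extAx : memLang.Sentence :=
  ((((mem' 3 2 0).iff (mem' 3 2 1)).all.imp (eq' 2 0 1)).all).all

def pairAx : memLang.Sentence :=
  ((((mem' 3 0 2) ⊓ (mem' 3 1 2)).ex).all).all

def unionAx : memLang.Sentence :=
  (((((mem' 4 2 3) ⊓ (mem' 4 3 0)).imp (mem' 4 2 1)).all.all).ex).all

def foundAx : memLang.Sentence :=
  (((mem' 2 1 0).ex.imp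
    (((mem' 2 1 0) ⊓ (((mem' 3 2 1).imp (mem' 3 2 0).not).all)).ex)).all)


def infAx₁ : memLang.BoundedFormula Empty 1 :=
  ((mem' 2 1 0) ⊓ ((mem' 3 2 1).not.all)).ex

def infAx₂ : memLang.BoundedFormula Empty 1 :=
  ((mem' 2 1 0).imp
    (((mem' 3 2 0) ⊓ ((mem' 3 1 2) ⊓
      (((mem' 4 3 2).iff ((mem' 4 3 1) ⊔ (eq' 4 3 1))).all))).ex)).all

def infAx : memLang.Sentence := (infAx₁ ⊓ infAx₂).ex

def choiceHyp₁ : memLang.BoundedFormula Empty 1 :=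
  ((mem' 2 1 0).imp ((mem' 3 2 1).ex)).all

def choiceHyp₂ : memLang.BoundedFormula Empty 1 :=
  ((((mem' 3 1 0) ⊓ ((mem' 3 2 0) ⊓ (eq' 3 1 2).not)).imp
     (((mem' 4 3 1) ⊓ (mem' 4 3 2)).ex.not)).all).all

def choiceConcl : memLang.BoundedFormula Empty 1 :=
  (((mem' 3 2 0).imp
    (((mem' 4 3 2) ⊓ ((mem' 4 3 1) ⊓
       ((((mem' 5 4 2) ⊓ (mem' 5 4 1)).imp (eq' 5 4 3)).all))).ex)).all).ex

def choiceAx : memLang.Sentence :=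
  (((choiceHyp₁ ⊓ choiceHyp₂).imp choiceConcl)).all

def sepAx (n : ℕ) (φ : memLang.BoundedFormula Empty (n + 2)) : memLang.Sentence :=
  (((((mem' (n+3) ⟨n+2, by omega⟩ ⟨n+1, by omega⟩).iff
      ((mem' (n+3) ⟨n+2, by omega⟩ ⟨n, by omega⟩) ⊓ (φ.liftAt 1 (n+1)))).all).ex).all).alls

def collAx (n : ℕ) (φ : memLang.BoundedFormula Empty (n + 3)) : memLang.Sentence :=
  (((((mem' (n+2) ⟨n+1, by omega⟩ ⟨n, by omega⟩).imp φ.ex).all).imp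
    ((((mem' (n+3) ⟨n+2, by omega⟩ ⟨n, by omega⟩).imp
        (((mem' (n+4) ⟨n+3, by omega⟩ ⟨n+1, by omega⟩) ⊓ (φ.liftAt 1 (n+1))).ex)).all).ex)).all).alls

def ZFCminus : Set memLang.Sentence :=
  {extAx, pairAx, unionAx, foundAx, infAx, choiceAx}
    ∪ (⋃ n, Set.range (sepAx n)) ∪ (⋃ n, Set.range (collAx n))

end

noncomputable section

/-! ## Satisfaction in transitive sets -/

instance zfStr (M : ZFSet.{0}) : memLang.Structure M.toSet where
  funMap := fun {_} f _ => f.elim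
  RelMap := fun {n} =>
    match n with
    | 2 => fun _ v => ((v 0 : M.toSet) : ZFSet) ∈ ((v 1 : M.toSet) : ZFSet)
    | 0 => fun r _ => r.elim
    | 1 => fun r _ => r.elim
    | (_+3) => fun r _ => r.elim

/-- Realization of a formula in the membership structure `(M, ∈)`, with a valuation
taking values in `M`. -/
def RealizeIn (M : ZFSet.{0}) {n : ℕ} (φ : memLang.BoundedFormula Empty n)
    (v : Fin n → ZFSet.{0}) : Prop :=
  ∃ hv : ∀ i, v i ∈ M, φ.Realize (fun e => e.elim) (fun i => (⟨v i, hv i⟩ : M.toSet))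

/-- `M ⊨ ZFC⁻`. -/
def ModelsZFCminus (M : ZFSet.{0}) : Prop :=
  ∀ φ ∈ ZFCminus, Sentence.Realize (↥M.toSet) φ

/-! ## Cardinals, ordinals and basic combinatorial notions -/

/-- The cardinality of (the extension of) a ZF-set. -/
def zcard (x : ZFSet.{0}) : Cardinal := Cardinal.mk x.toSet

/-- `κ` is a (von Neumann) cardinal. -/
def IsCardinalZ (κ : ZFSet.{0}) : Prop :=
  κ.IsOrdinal ∧ ∀ β ∈ κ, zcard β < zcard κ

/-- `κ^{<κ} = κ`. -/
def PowLtEqSelf (κ : ZFSet.{0}) : Prop :=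
  ∀ β ∈ κ, zcard κ ^ zcard β ≤ zcard κ

def zsucc (x : ZFSet.{0}) : ZFSet := insert x x

def natZ : ℕ → ZFSet.{0}
  | 0 => ∅
  | n+1 => zsucc (natZ n)

def iterSucc (β : ZFSet.{0}) : ℕ → ZFSet
  | 0 => β
  | n+1 => zsucc (iterSucc β n)

def IsLimitZ (α : ZFSet.{0}) : Prop := α.IsOrdinal ∧ α ≠ ∅ ∧ ∀ β ∈ α, zsucc β ∈ α

/-- The value `f(x)` of a ZF-coded function `f` at `x`. -/
def app (f x : ZFSet.{0}) : ZFSet :=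
  ⋃₀ (ZFSet.sep (fun y => ZFSet.pair x y ∈ f) (⋃₀ (⋃₀ f)))

/-- The restriction `f ↾ β` of a ZF-coded function. -/
def restrictF (f β : ZFSet.{0}) : ZFSet :=
  ZFSet.sep (fun z => ∃ ξ ∈ β, ∃ y, z = ZFSet.pair ξ y) f

/-! ## κ-models, elementary embeddings and weak compactness,
relative to an ambient class `W` of sets (`W = Set.univ` is the ground universe `V`). -/

/-- `M` is a κ-model (computed relative to the universe `W`): it is transitive, of size `κ`,
contains `κ`, is closed under `<κ`-sequences lying in `W`, and satisfies `ZFC⁻`. -/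
def IsKappaModelIn (W : Set ZFSet.{0}) (κ M : ZFSet.{0}) : Prop :=
  M ∈ W ∧ κ ∈ M ∧ M.IsTransitive ∧ zcard M = zcard κ ∧
  (∀ β ∈ κ, ∀ f : ZFSet, f ∈ W → ZFSet.IsFunc β M f → f ∈ M) ∧
  ModelsZFCminus M

abbrev IsKappaModel (κ M : ZFSet.{0}) : Prop := IsKappaModelIn Set.univ κ M

/-- `j` is an elementary embedding from `(M, ∈)` to `(N, ∈)`. -/
def IsElemEmbedding (M N : ZFSet.{0}) (j : ZFSet.{0} → ZFSet.{0}) : Prop :=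
  (∀ x ∈ M, j x ∈ N) ∧
  ∀ (n : ℕ) (φ : memLang.BoundedFormula Empty n) (v : Fin n → ZFSet),
    (∀ i, v i ∈ M) → (RealizeIn M φ v ↔ RealizeIn N φ (fun i => j (v i)))

/-- `j` has critical point `κ`: it fixes every ordinal below `κ` and moves `κ`. -/
def HasCritPoint (j : ZFSet.{0} → ZFSet.{0}) (κ : ZFSet.{0}) : Prop :=
  (∀ x ∈ κ, j x = x) ∧ κ ∈ j κ

/-- `S` is a weakly compact subset of `κ`, computed relative to the universe `W`:
for every `A ⊆ κ` in `W` there are κ-models `M ∋ A, S` and `N` and an elementary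
embedding `j : M → N` with critical point `κ` such that `κ ∈ j(S)`. -/
def IsWeaklyCompactIn (W : Set ZFSet.{0}) (κ S : ZFSet.{0}) : Prop :=
  S ⊆ κ ∧ ∀ A : ZFSet, A ∈ W → A ⊆ κ →
    ∃ (M N : ZFSet) (j : ZFSet → ZFSet),
      IsKappaModelIn W κ M ∧ IsKappaModelIn W κ N ∧ A ∈ M ∧ S ∈ M ∧
      IsElemEmbedding M N j ∧ HasCritPoint j κ ∧ κ ∈ j S

abbrev IsWeaklyCompactSubset (κ S : ZFSet.{0}) : Prop := IsWeaklyCompactIn Set.univ κ S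

/-- `κ` is a weakly compact cardinal (relative to the universe `W`). -/
def IsWCCardinalIn (W : Set ZFSet.{0}) (κ : ZFSet.{0}) : Prop :=
  IsCardinalZ κ ∧ PowLtEqSelf κ ∧ IsWeaklyCompactIn W κ κ

abbrev IsWCCardinal (κ : ZFSet.{0}) : Prop := IsWCCardinalIn Set.univ κ

/-! ## Clubs, stationarity, inaccessibility, Mahloness -/

/-- `C` is a closed unbounded subset of the ordinal `γ`. -/
def IsClubIn (C γ : ZFSet.{0}) : Prop :=
  C ⊆ γ ∧ (∀ ξ ∈ γ, ∃ η ∈ C, ξ ∈ η ∨ ξ = η) ∧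
  ∀ β ∈ γ, (∃ ξ, ξ ∈ β) → (∀ ξ ∈ β, ∃ η, η ∈ C ∧ η ∈ β ∧ ξ ∈ η) → β ∈ C

/-- `S` is a stationary subset of `γ`, relative to the universe `W`. -/
def IsStationaryIn (W : Set ZFSet.{0}) (S γ : ZFSet.{0}) : Prop :=
  ∀ C : ZFSet, C ∈ W → IsClubIn C γ → ∃ x, x ∈ S ∧ x ∈ C

/-- `γ` is a regular cardinal, relative to the universe `W`. -/
def IsRegularIn (W : Set ZFSet.{0}) (γ : ZFSet.{0}) : Prop :=
  IsCardinalZ γ ∧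
  ∀ β ∈ γ, ∀ f : ZFSet, f ∈ W → ZFSet.IsFunc β γ f →
    ∃ δ ∈ γ, ∀ ξ ∈ β, ∀ y, ZFSet.pair ξ y ∈ f → y ∈ δ

/-- `γ` is an inaccessible cardinal (regular, uncountable strong limit),
relative to the universe `W`. -/
def IsInaccessibleIn (W : Set ZFSet.{0}) (γ : ZFSet.{0}) : Prop :=
  IsRegularIn W γ ∧ ZFSet.omega ∈ γ ∧
  ∀ β ∈ γ, ¬ ∃ f : ZFSet, f ∈ W ∧ ZFSet.IsFunc γ (ZFSet.powerset β) f ∧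
    (∀ x x' y, ZFSet.pair x y ∈ f → ZFSet.pair x' y ∈ f → x = x')

/-- `γ` is a Mahlo cardinal: it is inaccessible and the inaccessibles below it
are stationary, relative to the universe `W`. -/
def IsMahloIn (W : Set ZFSet.{0}) (γ : ZFSet.{0}) : Prop :=
  IsInaccessibleIn W γ ∧
  IsStationaryIn W (ZFSet.sep (fun β => IsInaccessibleIn W β) γ) γ

/-- `C` is 1-closed in `κ`: it contains every inaccessible `γ < κ` in which `C ∩ γ`
is stationary (relative to the universe `W`). -/
def IsOneClosedIn (W : Set ZFSet.{0}) (C κ : ZFSet.{0}) : Prop :=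
  ∀ γ ∈ κ, IsInaccessibleIn W γ → IsStationaryIn W (C ∩ γ) γ → γ ∈ C

/-- `C` is 1-club in `κ`: stationary and 1-closed (relative to the universe `W`). -/
def IsOneClubIn (W : Set ZFSet.{0}) (C κ : ZFSet.{0}) : Prop :=
  IsStationaryIn W C κ ∧ IsOneClosedIn W C κ

/-! ## Traces and higher orders of weak compactness -/

/-- The weakly compact trace operation. -/
def wcTraceIn (W : Set ZFSet.{0}) (κ X : ZFSet.{0}) : ZFSet :=
  ZFSet.sep (fun γ => IsWeaklyCompactIn W γ (X ∩ γ)) κ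

/-- Finite iterates of the weakly compact trace operation (on the canonical
representatives of the classes `[X]₁`). -/
def iterWcTraceIn (W : Set ZFSet.{0}) (κ : ZFSet.{0}) : ℕ → ZFSet.{0} → ZFSet.{0}
  | 0, X => X
  | n+1, X => wcTraceIn W κ (iterWcTraceIn W κ n X)

/-- `κ` is an `n`-weakly compact cardinal (relative to the universe `W`):
all iterates `Tr^m_{wc}([κ]₁)` for `m < n` are nonzero, i.e. weakly compact. -/
def IsNWeaklyCompactIn (W : Set ZFSet.{0}) (κ : ZFSet.{0}) (n : ℕ) : Prop :=
  ∀ m < n, IsWeaklyCompactIn W κ (iterWcTraceIn W κ m κ)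

/-- `κ` is an `ω`-weakly compact cardinal (relative to the universe `W`). -/
def IsOmegaWeaklyCompactIn (W : Set ZFSet.{0}) (κ : ZFSet.{0}) : Prop :=
  ∀ n : ℕ, IsWeaklyCompactIn W κ (iterWcTraceIn W κ n κ)

/-- `S^β_n`: the Mahlo cardinals below `β` for `n = 0`, and the `n`-weakly compact
cardinals below `β` for `n > 0` (relative to the universe `W`). -/
def SsetIn (W : Set ZFSet.{0}) (β : ZFSet.{0}) : ℕ → ZFSet
  | 0 => ZFSet.sep (fun α => IsMahloIn W α) β
  | n+1 => ZFSet.sep (fun α => IsNWeaklyCompactIn W α (n+1)) β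

/-- The weakly compact reflection principle `Refl_wc(κ)` (relative to the universe `W`):
`κ` is weakly compact and every weakly compact subset of `κ` has a weakly compact
proper initial segment. -/
def ReflWcIn (W : Set ZFSet.{0}) (κ : ZFSet.{0}) : Prop :=
  IsWCCardinalIn W κ ∧
  ∀ S : ZFSet, S ∈ W → IsWeaklyCompactIn W κ S → ∃ γ ∈ κ, IsWeaklyCompactIn W γ (S ∩ γ)

end

noncomputable section

/-! ## Forcing notions, generic filters, names and generic extensions -/

/-- The order of a ZF-coded partial order: `p ≤ q` iff `(p, q) ∈ R`. -/
def zle (R p q : ZFSet.{0}) : Prop := ZFSet.pair p q ∈ R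

/-- `(P, R)` is a ZF-coded partial order (a forcing notion). -/
def IsPosetOn (P R : ZFSet.{0}) : Prop :=
  R ⊆ ZFSet.prod P P ∧ (∀ p ∈ P, zle R p p) ∧
  ∀ p q r : ZFSet, zle R p q → zle R q r → zle R p r

/-- `D` is a dense subset of the forcing notion `(P, R)`. -/
def IsDenseIn (P R D : ZFSet.{0}) : Prop :=
  D ⊆ P ∧ ∀ p ∈ P, ∃ q ∈ D, zle R q p

/-- `G` (a class of conditions) is a filter on `(P, R)`. -/
def IsClassFilterOn (P R : ZFSet.{0}) (G : Set ZFSet.{0}) : Prop :=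
  (∀ p ∈ G, p ∈ P) ∧ (∀ p ∈ G, ∀ q, q ∈ P → zle R p q → q ∈ G) ∧
  ∀ p ∈ G, ∀ q ∈ G, ∃ r, r ∈ G ∧ zle R r p ∧ zle R r q

/-- `G` is generic over the universe `V` for `(P, R)`: it is a filter meeting every
dense subset of `P` (lying in `V`). -/
def IsGenericOverV (P R : ZFSet.{0}) (G : Set ZFSet.{0}) : Prop :=
  IsClassFilterOn P R G ∧ ∀ D : ZFSet, IsDenseIn P R D → ∃ q, q ∈ G ∧ q ∈ D

/-- `G` is generic for `(P, R)` over the class `W`: it is a filter meeting every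
dense subset of `P` lying in `W`. -/
def IsGenericOverClass (W : Set ZFSet.{0}) (P R : ZFSet.{0}) (G : Set ZFSet.{0}) : Prop :=
  IsClassFilterOn P R G ∧ ∀ D : ZFSet, D ∈ W → IsDenseIn P R D → ∃ q, q ∈ G ∧ q ∈ D

/-- A ZF-coded filter on `(P, R)`. -/
def IsSetFilterOn (P R G : ZFSet.{0}) : Prop :=
  G ⊆ P ∧ (∀ p ∈ G, ∀ q ∈ P, zle R p q → q ∈ G) ∧
  ∀ p ∈ G, ∀ q ∈ G, ∃ r ∈ G, zle R r p ∧ zle R r q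

/-- `G` is a filter on `(P, R)` generic over the (set) model `M`. -/
def IsGenericOverSet (M P R G : ZFSet.{0}) : Prop :=
  IsSetFilterOn P R G ∧ ∀ D : ZFSet, D ∈ M → IsDenseIn P R D → ∃ q ∈ G, q ∈ D

/-- The image of a ZF-set under an arbitrary (class) function. -/
def myImage (f : ZFSet.{0} → ZFSet.{0}) (x : ZFSet.{0}) : ZFSet.{0} :=
  ZFSet.range.{0,0} (fun a : (Quotient.out x).Type => f (ZFSet.mk ((Quotient.out x).Func a)))

/-- The evaluation `val_G(τ)` of a `P`-name `τ` by a filter `G`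
(every ZF-set is regarded as a name). -/
def zval (G : Set ZFSet.{0}) : ZFSet.{0} → ZFSet.{0} :=
  (ZFSet.mem_wf.transGen).fix (fun τ rec =>
    myImage (fun σ => if h : Relation.TransGen (· ∈ ·) σ τ then rec σ h else ∅)
      (ZFSet.sep (fun σ => ∃ p, p ∈ G ∧ ZFSet.pair σ p ∈ τ) (⋃₀ (⋃₀ τ : ZFSet))))

/-- The generic extension `V[G]` of the universe, as a class: all evaluations of names. -/
def VofG (G : Set ZFSet.{0}) : Set ZFSet.{0} := Set.range (zval G)

/-- The generic extension `M[G]` of a set model `M` by a class filter `G`: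
the evaluations of all names lying in `M`. -/
def extClass (M : ZFSet.{0}) (G : Set ZFSet.{0}) : ZFSet.{0} := myImage (zval G) M

/-- The generic extension `M[G]` of a set model `M` by a set filter `G`. -/
def extSet (M G : ZFSet.{0}) : ZFSet.{0} := extClass M {x | x ∈ G}

/-- The check-name `x̌` of a ground model set `x` (relative to the forcing `P`). -/
def checkName (P : ZFSet.{0}) : ZFSet.{0} → ZFSet.{0} :=
  ZFSet.mem_wf.fix (fun x rec =>
    ⋃₀ (myImage (fun y => if h : y ∈ x then myImage (fun p => ZFSet.pair (rec y h) p) P else ∅) x))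

/-- The canonical name `Ġ` for the generic filter. -/
def genName (P : ZFSet.{0}) : ZFSet.{0} :=
  myImage (fun p => ZFSet.pair (checkName P p) p) P

/-- The ground model `V`, as a class. -/
def GroundV : Set ZFSet.{0} := Set.univ

/-- `(P, R)` is `κ`-c.c.: every antichain has size `< κ`. -/
def IsKappaCC (P R κ : ZFSet.{0}) : Prop :=
  ∀ A : ZFSet, A ⊆ P →
    (∀ p ∈ A, ∀ q ∈ A, p ≠ q → ¬ ∃ r ∈ P, zle R r p ∧ zle R r q) →
    zcard A < zcard κ

/-! ## Games and strategic closure -/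

/-- It is Player II's turn at stage `α`: `α` is a limit ordinal, or of the form `λ + (2n+1)`
(Player I moves first, at stage `0`, and Player II plays first at limit stages). -/
def IsIITurn (α : ZFSet.{0}) : Prop :=
  IsLimitZ α ∨ ∃ (β : ZFSet) (n : ℕ), (β = ∅ ∨ IsLimitZ β) ∧ α = iterSucc β (2*n+1)

/-- `f` is a ZF-coded descending sequence of conditions of `(P, R)` of length `α`. -/
def IsDescPlay (P R α f : ZFSet.{0}) : Prop :=
  ZFSet.IsFunc α P f ∧ ∀ β ∈ α, ∀ γ ∈ β, zle R (app f β) (app f γ)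

/-- `s` is (the graph of) a deterministic strategy. -/
def IsFunctionLike (s : ZFSet.{0}) : Prop :=
  ∀ x y y', ZFSet.pair x y ∈ s → ZFSet.pair x y' ∈ s → y = y'

/-- `s` is a winning strategy for Player II in the game `G_δ(P)`: along any descending play
(lying in the universe `W`) in which Player II has followed `s`, when it is Player II's turn
`s` provides a condition below all conditions played so far. -/
def IsWinningStratII (W : Set ZFSet.{0}) (P R δ s : ZFSet.{0}) : Prop :=
  ∀ α ∈ δ, ∀ f : ZFSet, f ∈ W → IsDescPlay P R α f →
    (∀ β ∈ α, IsIITurn β → ZFSet.pair (restrictF f β) (app f β) ∈ s) →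
    IsIITurn α →
    ∃ q, ZFSet.pair (restrictF f α) q ∈ s ∧ q ∈ P ∧ ∀ γ ∈ α, zle R q (app f γ)

/-- `(P, R)` is `δ`-strategically closed, relative to the universe `W`:
Player II has a winning strategy in the game of length `δ`. -/
def IsStratClosedIn (W : Set ZFSet.{0}) (P R δ : ZFSet.{0}) : Prop :=
  ∃ s, s ∈ W ∧ IsFunctionLike s ∧ IsWinningStratII W P R δ s

/-- `(P, R)` is `<κ`-strategically closed relative to `W`. -/
def IsLtStratClosedIn (W : Set ZFSet.{0}) (P R κ : ZFSet.{0}) : Prop :=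
  ∀ δ ∈ κ, IsStratClosedIn W P R δ

/-- `(P, R)` is `α⁺`-closed: every descending sequence of length `< α⁺`
(i.e. of length an ordinal of size `≤ |α|`) has a lower bound in `P`. -/
def IsSuccCardClosed (P R α : ZFSet.{0}) : Prop :=
  ∀ β : ZFSet, β.IsOrdinal → zcard β ≤ zcard α →
    ∀ f : ZFSet, IsDescPlay P R β f → ∃ q ∈ P, ∀ γ ∈ β, zle R q (app f γ)

/-! ## The 1-club shooting forcing `T¹(X)` -/

/-- `c` is bounded below `κ`. -/
def IsBoundedBelow (c κ : ZFSet.{0}) : Prop := ∃ β ∈ κ, c ⊆ β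

/-- The poset `T¹(X)` of bounded 1-closed subsets of `X ⊆ κ`, relative to the universe `W`. -/
def T1In (W : Set ZFSet.{0}) (κ X : ZFSet.{0}) : ZFSet :=
  ZFSet.sep (fun c => c ∈ W ∧ IsBoundedBelow c κ ∧ IsOneClosedIn W c κ) (ZFSet.powerset X)

abbrev T1 (κ X : ZFSet.{0}) : ZFSet := T1In Set.univ κ X

/-- `c₁` end-extends `c₂` (i.e. `c₁ ≤ c₂` in `T¹(X)`). -/
def IsEndExtension (c₁ c₂ : ZFSet.{0}) : Prop :=
  c₂ ⊆ c₁ ∧ ∀ x ∈ c₁, x ∉ c₂ → ∀ y ∈ c₂, y ∈ x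

/-- The end-extension order on `T¹(X)`, as a ZF-coded relation. -/
def T1OrderIn (W : Set ZFSet.{0}) (κ X : ZFSet.{0}) : ZFSet :=
  ZFSet.pairSep (fun c₁ c₂ => IsEndExtension c₁ c₂) (T1In W κ X) (T1In W κ X)

abbrev T1Order (κ X : ZFSet.{0}) : ZFSet := T1OrderIn Set.univ κ X

end

noncomputable section

/-! ## The von Neumann hierarchy -/

/-- The von Neumann hierarchy `V_α` (for `α` an ordinal): `V_x = ⋃_{y ∈ x} 𝒫(V_y)`. -/
def Vrank : ZFSet.{0} → ZFSet.{0} :=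
  ZFSet.mem_wf.fix (fun x rec =>
    ⋃₀ (myImage (fun y => if h : y ∈ x then ZFSet.powerset (rec y h) else ∅) x))

/-! ## Π¹₁-indescribability -/

/-- The language with a membership relation and two unary predicates
(for the parameter `A` and a second-order variable `X`). -/
def memLang2 : Language where
  Functions := fun _ => Empty
  Relations := fun n => match n with | 1 => Fin 2 | 2 => Unit | _ => Empty

/-- The structure `(Vκ, ∈, A, B)`. -/
def str2 (Vk A B : ZFSet.{0}) : memLang2.Structure (↥Vk.toSet) where
  funMap := fun {_} f _ => f.elim
  RelMap := fun {n} =>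
    match n with
    | 1 => fun (r : Fin 2) v => if r = 0 then (((v 0 : Vk.toSet) : ZFSet) ∈ A)
                      else (((v 0 : Vk.toSet) : ZFSet) ∈ B)
    | 2 => fun _ v => ((v 0 : Vk.toSet) : ZFSet) ∈ ((v 1 : Vk.toSet) : ZFSet)
    | 0 => fun r _ => r.elim
    | (_+3) => fun r _ => r.elim

/-- `(Vk, ∈, A) ⊨ ∀X ψ(X)`: the Π¹₁-sentence with first-order matrix `ψ` holds in
`(Vk, ∈, A)`, where the second-order universal quantifier ranges over all subsets of `Vk`. -/
def SatisfiesPi11 (Vk A : ZFSet.{0}) (ψ : memLang2.Sentence) : Prop :=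
  ∀ B : ZFSet, B ⊆ Vk → @Sentence.Realize memLang2 _ (str2 Vk A B) ψ

/-! ## Products of 1-club shooting forcings, and lottery sums -/

/-- The ZF-coded set `[m, ω)` of natural numbers `≥ m`. -/
def omegaFrom (m : ℕ) : ZFSet.{0} :=
  ZFSet.sep (fun n => natZ m ⊆ n) ZFSet.omega

/-- The product `∏_{n ∈ [m, ω)} T¹(γ \ S^γ_n)`, computed relative to the universe `W`. -/
def prodT1In (W : Set ZFSet.{0}) (γ : ZFSet.{0}) (m : ℕ) : ZFSet :=
  ZFSet.sep
    (fun f => f ∈ W ∧ ZFSet.IsFunc (omegaFrom m) (ZFSet.powerset γ) f ∧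
      ∀ n : ℕ, m ≤ n → app f (natZ n) ∈ T1In W γ (γ \ SsetIn W γ n))
    (ZFSet.powerset (ZFSet.prod (omegaFrom m) (ZFSet.powerset γ)))

/-- The (pointwise end-extension) order on the product. -/
def prodT1Le (f g : ZFSet.{0}) (m : ℕ) : Prop :=
  ∀ n : ℕ, m ≤ n → IsEndExtension (app f (natZ n)) (app g (natZ n))

/-- The lottery sum `⊕_{m<ω} ∏_{n ∈ [m,ω)} T¹(γ \ S^γ_n)`, relative to the universe `W`;
`∅` serves as the top element `1`. -/
def lotterySumIn (W : Set ZFSet.{0}) (γ : ZFSet.{0}) : ZFSet :=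
  insert ∅ (ZFSet.sep
    (fun z => ∃ (m : ℕ) (f : ZFSet), z = ZFSet.pair (natZ m) f ∧ f ∈ prodT1In W γ m)
    (ZFSet.prod ZFSet.omega (ZFSet.powerset (ZFSet.prod ZFSet.omega (ZFSet.powerset γ)))))

/-- The order on the lottery sum: everything is below the top `∅`, and
`(m, f) ≤ (m', g)` iff `m = m'` and `f ≤ g` pointwise. -/
def lotteryLeIn (W : Set ZFSet.{0}) (γ : ZFSet.{0}) (a b : ZFSet.{0}) : Prop :=
  b = ∅ ∨ ∃ (m : ℕ) (f g : ZFSet), a = ZFSet.pair (natZ m) f ∧ b = ZFSet.pair (natZ m) g ∧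
    f ∈ prodT1In W γ m ∧ g ∈ prodT1In W γ m ∧ prodT1Le f g m

/-- The order on the lottery sum, as a ZF-coded relation. -/
def lotteryOrderIn (W : Set ZFSet.{0}) (γ : ZFSet.{0}) : ZFSet :=
  ZFSet.pairSep (fun a b => lotteryLeIn W γ a b) (lotterySumIn W γ) (lotterySumIn W γ)

/-! ## Easton-support iterations -/

/-- `p` is a ZF-coded function with domain `α`. -/
def IsFuncWithDomain (p α : ZFSet.{0}) : Prop := ∃ y : ZFSet, ZFSet.IsFunc α y p

/-- `p` (a condition of an iteration of length `α`) has Easton support: its support is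
bounded below every inaccessible `δ ≤ α` (stages where `p` takes the trivial value `∅`
are outside the support). -/
def HasEastonSupport (p α : ZFSet.{0}) : Prop :=
  ∀ δ : ZFSet, IsInaccessibleIn Set.univ δ → (δ ∈ α ∨ δ = α) →
    ∃ β ∈ δ, ∀ ξ ∈ δ, app p ξ ≠ ∅ → ξ ∈ β

/-- The restriction of a class filter `G` on an iteration to the first `β` stages. -/
def resFilter (G : Set ZFSet.{0}) (β : ZFSet.{0}) : Set ZFSet.{0} :=
  {q | ∃ p, p ∈ G ∧ q = restrictF p β}

/-- `⟨(P_α, Q̇_α) : α < κ⟩` is an Easton-support forcing iteration (described by the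
cumulative sequence of initial segments `Pseq α` with orders `Rseq α`, whose conditions
are functions with domain `α` and Easton support, coherent under restriction). -/
structure IsEastonIteration (κ : ZFSet.{0}) (Pseq Rseq : ZFSet.{0} → ZFSet.{0}) : Prop where
  isOrd : κ.IsOrdinal
  poset : ∀ α : ZFSet, α.IsOrdinal → (α ∈ κ ∨ α = κ) → IsPosetOn (Pseq α) (Rseq α)
  conds : ∀ α : ZFSet, α.IsOrdinal → (α ∈ κ ∨ α = κ) →
    ∀ p ∈ Pseq α, IsFuncWithDomain p α ∧ HasEastonSupport p α
  coherMem : ∀ α : ZFSet, α.IsOrdinal → (α ∈ κ ∨ α = κ) →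
    ∀ β ∈ α, ∀ p ∈ Pseq α, restrictF p β ∈ Pseq β
  coherLe : ∀ α : ZFSet, α.IsOrdinal → (α ∈ κ ∨ α = κ) →
    ∀ β ∈ α, ∀ p ∈ Pseq α, ∀ q ∈ Pseq α,
      zle (Rseq α) p q → zle (Rseq β) (restrictF p β) (restrictF q β)
  genRes : ∀ α : ZFSet, α.IsOrdinal → (α ∈ κ ∨ α = κ) → ∀ β ∈ α,
    ∀ G : Set ZFSet, IsGenericOverV (Pseq α) (Rseq α) G →
      IsGenericOverV (Pseq β) (Rseq β) (resFilter G β)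

/-- The main iteration of the paper: the Easton-support iteration which, at each stage
`γ < κ` that is Mahlo in `V`, forces with the lottery sum
`⊕_{m<ω} ∏_{n ∈ [m,ω)} T¹(γ \ S^γ_n)` as computed in `V^{P_γ}`, and trivially at
other stages.  The stage-`γ` behaviour is described by evaluating the stage-`γ`
components of conditions by a generic for the first `γ` stages. -/
structure IsMainIteration (κ : ZFSet.{0}) (Pseq Rseq : ZFSet.{0} → ZFSet.{0})
    extends IsEastonIteration κ Pseq Rseq : Prop where
  trivialStage : ∀ γ ∈ κ, ¬ IsMahloIn Set.univ γ → ∀ p ∈ Pseq κ, app p γ = ∅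
  lotteryStage : ∀ γ ∈ κ, IsMahloIn Set.univ γ →
    ∀ G : Set ZFSet, IsGenericOverV (Pseq γ) (Rseq γ) G →
      (∀ p ∈ Pseq (zsucc γ), zval G (app p γ) ∈ lotterySumIn (VofG G) γ) ∧
      (∀ q ∈ lotterySumIn (VofG G) γ, ∃ p ∈ Pseq (zsucc γ), zval G (app p γ) = q) ∧
      (∀ p ∈ Pseq (zsucc γ), ∀ q ∈ Pseq (zsucc γ), zle (Rseq (zsucc γ)) p q →
        zle (lotteryOrderIn (VofG G) γ) (zval G (app p γ)) (zval G (app q γ)))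

/-- An Easton-support iteration all of whose stages are (forced to be)
`α`-strategically closed. -/
structure IsStratClosedIteration (κ : ZFSet.{0}) (Pseq Rseq : ZFSet.{0} → ZFSet.{0})
    extends IsEastonIteration κ Pseq Rseq : Prop where
  stageClosed : ∀ α ∈ κ,
    ∀ G : Set ZFSet, IsGenericOverV (Pseq α) (Rseq α) G →
      ∃ Q R' : ZFSet, Q ∈ VofG G ∧ R' ∈ VofG G ∧ IsPosetOn Q R' ∧
        IsStratClosedIn (VofG G) Q R' α ∧
        (∀ p ∈ Pseq (zsucc α), zval G (app p α) ∈ Q) ∧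
        (∀ q ∈ Q, ∃ p ∈ Pseq (zsucc α), zval G (app p α) = q) ∧
        (∀ p ∈ Pseq (zsucc α), ∀ q ∈ Pseq (zsucc α), zle (Rseq (zsucc α)) p q →
          zle R' (zval G (app p α)) (zval G (app q α)))

end

noncomputable section

/-! ## Miscellaneous auxiliary notions used in the statements -/

/-- `M` is an elementary substructure of `(H, ∈)`. -/
def IsElemSubstructure (M H : ZFSet.{0}) : Prop :=
  M ⊆ H ∧ ∀ (n : ℕ) (φ : memLang.BoundedFormula Empty n) (v : Fin n → ZFSet),
    (∀ i, v i ∈ M) → (RealizeIn M φ v ↔ RealizeIn H φ v)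

/-- `H = H_{κ⁺}`: the sets whose transitive closure has size at most `κ`. -/
def IsHkappaPlus (κ H : ZFSet.{0}) : Prop :=
  ∀ x : ZFSet, x ∈ H ↔ ∃ t : ZFSet, x ⊆ t ∧ t.IsTransitive ∧ zcard t ≤ zcard κ

/-- `I` is a (proper) ideal on `lam`. -/
def IsIdealOn (lam I : ZFSet.{0}) : Prop :=
  (∀ X ∈ I, X ⊆ lam) ∧ ∅ ∈ I ∧ lam ∉ I ∧
  (∀ X ∈ I, ∀ Y : ZFSet, Y ⊆ X → Y ∈ I) ∧
  (∀ X ∈ I, ∀ Y ∈ I, X ∪ Y ∈ I)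

/-- `I` is `lam`-complete: it is closed under unions of fewer than `lam` members. -/
def IsLamCompleteIdeal (lam I : ZFSet.{0}) : Prop :=
  ∀ x : ZFSet, x ⊆ I → zcard x < zcard lam → (⋃₀ x : ZFSet) ∈ I

/-- `I` is a normal `lam`-complete (proper) ideal on `lam`: every regressive ZF-coded
function on an `I`-positive set is constant on an `I`-positive set. -/
def IsNormalIdealOn (lam I : ZFSet.{0}) : Prop :=
  IsIdealOn lam I ∧ IsLamCompleteIdeal lam I ∧
  ∀ S : ZFSet, S ⊆ lam → S ∉ I →
    ∀ f : ZFSet, ZFSet.IsFunc S lam f → (∀ α ∈ S, α ≠ ∅ → app f α ∈ α) →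
      ∃ β ∈ lam, ZFSet.sep (fun α => ZFSet.pair α β ∈ f) S ∉ I

/-- The pair `(W, V)` has the `δ`-approximation property. -/
def HasApproxProperty (W : Set ZFSet.{0}) (δ : ZFSet.{0}) : Prop :=
  ∀ A : ZFSet, (∀ a ∈ A, a ∈ W) →
    (∀ a : ZFSet, a ∈ W → zcard a < zcard δ → A ∩ a ∈ W) → A ∈ W

/-- The pair `(W, V)` has the `δ`-cover property. -/
def HasCoverProperty (W : Set ZFSet.{0}) (δ : ZFSet.{0}) : Prop :=
  ∀ A : ZFSet, (∀ a ∈ A, a ∈ W) → zcard A < zcard δ →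
    ∃ B : ZFSet, B ∈ W ∧ A ⊆ B ∧ zcard B < zcard δ

/-- The dense set `D_α = {c ∈ T¹(X) : sup c > α⁺}` (a set `c` has `sup c > α⁺` iff it
contains an ordinal of cardinality greater than `|α|`). -/
def DsetT1 (κ X α : ZFSet.{0}) : ZFSet :=
  ZFSet.sep (fun c => ∃ ξ ∈ c, zcard α < zcard ξ) (T1 κ X)

/-- The `1`-club `C = ⋃ {f(m) : f ∈ I_γ}` added by the product selected by the lottery
held at stage `γ` of the main iteration. -/
def stageClub (G : Set ZFSet.{0}) (γ : ZFSet.{0}) (m : ℕ) : ZFSet :=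
  ZFSet.sep (fun ξ => ∃ p, p ∈ G ∧ ∃ f : ZFSet,
    zval (resFilter G γ) (app p γ) = ZFSet.pair (natZ m) f ∧ ξ ∈ app f (natZ m)) γ

end

/-- `P M v` is expressed, uniformly in the transitive set `M`, by one first-order formula. -/
def IsDefinablePred {n : ℕ} (P : ZFSet.{0} → (Fin n → ZFSet.{0}) → Prop) : Prop :=
  ∃ φ : memLang.BoundedFormula Empty n, ∀ M : ZFSet.{0}, M.IsTransitive →
    ∀ (v : Fin n → ZFSet.{0}) (hv : ∀ i, v i ∈ M),
      φ.Realize (fun e => e.elim) (fun i => (⟨v i, hv i⟩ : M.toSet)) ↔ P M v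

namespace IsDefinablePred

variable {n : ℕ} {P Q : ZFSet.{0} → (Fin n → ZFSet.{0}) → Prop}
  {R : ZFSet.{0} → (Fin n → ZFSet.{0}) → ZFSet.{0} → Prop}

theorem congr (hP : IsDefinablePred P)
    (h : ∀ M : ZFSet.{0}, M.IsTransitive → ∀ v : Fin n → ZFSet.{0}, (∀ i, v i ∈ M) →
      (P M v ↔ Q M v)) : IsDefinablePred Q := by
  obtain ⟨φ, hφ⟩ := hP
  exact ⟨φ, fun M hM v hv => (hφ M hM v hv).trans (h M hM v hv)⟩

theorem mem (i j : Fin n) : IsDefinablePred (fun _ v => v i ∈ v j) :=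
  ⟨mem' n i j, fun M _ v hv => by
    rw [mem', BoundedFormula.realize_rel₂]; rfl⟩

theorem eq (i j : Fin n) : IsDefinablePred (fun _ v => v i = v j) :=
  ⟨eq' n i j, fun M _ v hv => by simp [eq']⟩

theorem not (hP : IsDefinablePred P) : IsDefinablePred (fun M v => ¬ P M v) := by
  obtain ⟨φ, hφ⟩ := hP
  exact ⟨φ.not, fun M hM v hv => by rw [BoundedFormula.realize_not, hφ M hM]⟩

theorem imp (hP : IsDefinablePred P) (hQ : IsDefinablePred Q) :
    IsDefinablePred (fun M v => P M v → Q M v) := by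
  obtain ⟨φ, hφ⟩ := hP
  obtain ⟨ψ, hψ⟩ := hQ
  exact ⟨φ.imp ψ, fun M hM v hv => by rw [BoundedFormula.realize_imp, hφ M hM, hψ M hM]⟩

theorem and (hP : IsDefinablePred P) (hQ : IsDefinablePred Q) :
    IsDefinablePred (fun M v => P M v ∧ Q M v) :=
  (hP.imp hQ.not).not.congr fun _ _ _ _ => by tauto

theorem or (hP : IsDefinablePred P) (hQ : IsDefinablePred Q) :
    IsDefinablePred (fun M v => P M v ∨ Q M v) :=
  (hP.not.imp hQ).congr fun _ _ _ _ => by tauto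

theorem all
    (h : IsDefinablePred (fun M (w : Fin (n + 1) → ZFSet.{0}) =>
      R M (fun i => w i.castSucc) (w (Fin.last n)))) :
    IsDefinablePred (fun M v => ∀ x ∈ M, R M v x) := by
  obtain ⟨φ, hφ⟩ := h
  refine ⟨φ.all, fun M hM v hv => ?_⟩
  rw [BoundedFormula.realize_all, Subtype.forall]
  refine forall₂_congr fun x hx => ?_
  have hw : ∀ i, (Fin.snoc v x : Fin (n + 1) → ZFSet) i ∈ M := by
    intro i
    induction i using Fin.lastCases with
    | last => rw [Fin.snoc_last]; exact hx
    | cast i => simpa using hv i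
  have key := hφ M hM _ hw
  simp only [Fin.snoc_castSucc, Fin.snoc_last] at key
  rw [← key]
  refine iff_of_eq (congrArg _ (funext fun i => ?_))
  induction i using Fin.lastCases with
  | last => simp
  | cast i => simp

theorem ex
    (h : IsDefinablePred (fun M (w : Fin (n + 1) → ZFSet.{0}) =>
      R M (fun i => w i.castSucc) (w (Fin.last n)))) :
    IsDefinablePred (fun M v => ∃ x ∈ M, R M v x) :=
  (all (R := fun M v x => ¬ R M v x) h.not).not.congr fun _ _ _ _ => by push Not; rfl

theorem ball (j : Fin n)
    (h : IsDefinablePred (fun M (w : Fin (n + 1) → ZFSet.{0}) =>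
      R M (fun i => w i.castSucc) (w (Fin.last n)))) :
    IsDefinablePred (fun M v => ∀ x ∈ v j, R M v x) :=
  (all (R := fun M v x => x ∈ v j → R M v x) ((mem _ _).imp h)).congr fun _ hM _ hv =>
    ⟨fun H x hx => H x (hM.mem_trans hx (hv j)) hx, fun H x _ hx => H x hx⟩

theorem bex (j : Fin n)
    (h : IsDefinablePred (fun M (w : Fin (n + 1) → ZFSet.{0}) =>
      R M (fun i => w i.castSucc) (w (Fin.last n)))) :
    IsDefinablePred (fun M v => ∃ x ∈ v j, R M v x) :=
  (ball (R := fun M v x => ¬ R M v x) j h.not).not.congr fun _ _ _ _ => by push Not; rfl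

theorem eq_zsucc (i j : Fin n) : IsDefinablePred (fun _ v => v i = zsucc (v j)) := by
  have h : IsDefinablePred (fun _ (v : Fin n → ZFSet.{0}) =>
      v j ∈ v i ∧ (∀ x ∈ v j, x ∈ v i) ∧ ∀ x ∈ v i, x = v j ∨ x ∈ v j) :=
    (mem j i).and ((ball j (mem _ _)).and (ball i ((eq _ _).or (mem _ _))))
  refine h.congr fun _ _ v _ => ?_
  simp only [zsucc, ZFSet.ext_iff, mem_insert_iff]
  constructor
  · rintro ⟨h1, h2, h3⟩ z
    refine ⟨fun hz => ?_, ?_⟩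
    · simpa [ZFSet.ext_iff] using h3 z hz
    · rintro (hz | hz)
      · rwa [ZFSet.ext hz]
      · exact h2 z hz
  · intro H
    refine ⟨(H _).2 (Or.inl fun _ => Iff.rfl), fun x hx => (H x).2 (Or.inr hx), fun x hx => (H x).1 hx⟩

theorem eq_pair (i j k : Fin n) : IsDefinablePred (fun _ v => v k = pair (v i) (v j)) := by
  have h : IsDefinablePred (fun _ (v : Fin n → ZFSet.{0}) =>
      ∃ a ∈ v k, ∃ b ∈ v k, (∀ z ∈ v k, z = a ∨ z = b) ∧ (v i ∈ a ∧ ∀ z ∈ a, z = v i) ∧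
        (v i ∈ b ∧ v j ∈ b ∧ ∀ z ∈ b, z = v i ∨ z = v j)) :=
    bex k (bex _ ((ball _ ((eq _ _).or (eq _ _))).and
      (((mem _ _).and (ball _ (eq _ _))).and
        ((mem _ _).and ((mem _ _).and (ball _ ((eq _ _).or (eq _ _))))))))
  refine h.congr fun _ _ v _ => ?_
  constructor
  · rintro ⟨a, ha, b, hb, h1, ⟨h2, h3⟩, h4, h5, h6⟩
    have ea : a = {v i} := by
      ext z
      rw [mem_singleton]
      exact ⟨h3 z, fun e => e ▸ h2⟩
    have eb : b = {v i, v j} := by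
      ext z
      rw [mem_pair]
      refine ⟨h6 z, ?_⟩
      rintro (e | e)
      · exact e ▸ h4
      · exact e ▸ h5
    ext z
    rw [pair, mem_pair, ← ea, ← eb]
    refine ⟨h1 z, ?_⟩
    rintro (e | e)
    · exact e ▸ ha
    · exact e ▸ hb
  · intro e
    refine ⟨{v i}, by simp [e, pair], {v i, v j}, by simp [e, pair], ?_⟩
    simp [e, pair]

theorem pair_mem (i j k : Fin n) : IsDefinablePred (fun _ v => pair (v i) (v j) ∈ v k) := by
  have h : IsDefinablePred (fun _ (v : Fin n → ZFSet.{0}) =>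
      ∃ p ∈ v k, p = pair (v i) (v j)) := bex k (eq_pair _ _ _)
  exact h.congr fun _ _ v _ => by simp

theorem realizeIn_iff {φ : memLang.BoundedFormula Empty n} {M : ZFSet.{0}}
    {v : Fin n → ZFSet.{0}} (hv : ∀ i, v i ∈ M) :
    RealizeIn M φ v ↔ φ.Realize (fun e => e.elim) (fun i => (⟨v i, hv i⟩ : M.toSet)) :=
  ⟨fun h => h.2, fun h => ⟨hv, h⟩⟩

/-- Elementary embeddings preserve definable predicates. -/
theorem elem (hP : IsDefinablePred P) {M N : ZFSet.{0}} (hM : M.IsTransitive)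
    (hN : N.IsTransitive) {j : ZFSet.{0} → ZFSet.{0}} (hj : IsElemEmbedding M N j)
    {v : Fin n → ZFSet.{0}} (hv : ∀ i, v i ∈ M) : P M v ↔ P N (fun i => j (v i)) := by
  obtain ⟨φ, hφ⟩ := hP
  rw [← hφ M hM v hv, ← hφ N hN _ (fun i => hj.1 _ (hv i)), ← realizeIn_iff, ← realizeIn_iff]
  exact hj.2 n φ v hv

theorem exists_sep {P : ZFSet.{0} → (Fin 3 → ZFSet.{0}) → Prop} (hP : IsDefinablePred P)
    {M : ZFSet.{0}} (hM : M.IsTransitive) (hZ : ModelsZFCminus M) {a b : ZFSet.{0}}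
    (ha : a ∈ M) (hb : b ∈ M) : ∃ c ∈ M, ∀ x, x ∈ c ↔ x ∈ a ∧ P M ![b, a, x] := by
  obtain ⟨φ, hφ⟩ := hP
  have h := hZ (sepAx 1 φ) (Or.inl (Or.inr (Set.mem_iUnion.2 ⟨1, φ, rfl⟩)))
  rw [sepAx, Sentence.Realize, BoundedFormula.realize_alls] at h
  have h1 := h (fun _ => ⟨b, hb⟩)
  rw [BoundedFormula.realize_all] at h1
  have h2 := h1 ⟨a, ha⟩
  rw [BoundedFormula.realize_ex] at h2
  obtain ⟨⟨c, hc⟩, h3⟩ := h2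
  rw [BoundedFormula.realize_all] at h3
  refine ⟨c, hc, fun x => ?_⟩
  have key : ∀ hx : x ∈ M, x ∈ c ↔ x ∈ a ∧ P M ![b, a, x] := by
    intro hx
    have h4 := h3 ⟨x, hx⟩
    rw [BoundedFormula.realize_iff, BoundedFormula.realize_inf,
      BoundedFormula.realize_liftAt_one (by omega), mem', mem', BoundedFormula.realize_rel₂,
      BoundedFormula.realize_rel₂] at h4
    rw [← hφ M hM ![b, a, x] (by intro i; fin_cases i <;> simpa)]
    convert h4 using 2
    · exact Iff.rfl
    · exact Iff.rfl
    · refine iff_of_eq ?_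
      congr 1
      · exact Subsingleton.elim _ _
      · funext i
        fin_cases i <;> rfl
  exact ⟨fun h => (key (hM.mem_trans h hc)).1 h, fun h => (key (hM.mem_trans h.1 ha)).2 h⟩

end IsDefinablePred

section

variable {γ M : ZFSet.{0}}

/-- The graph of `g` restricted to `β`, for `g` mapping `β` into `M`. -/
noncomputable def graphOn (g : ZFSet.{0} → ZFSet.{0}) (β M : ZFSet.{0}) : ZFSet.{0} :=
  ZFSet.sep (fun p => ∃ x ∈ β, p = pair x (g x)) (prod β M)

theorem pair_mem_graphOn {g : ZFSet.{0} → ZFSet.{0}} {β : ZFSet.{0}} (hg : ∀ x ∈ β, g x ∈ M)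
    {x y : ZFSet.{0}} : pair x y ∈ graphOn g β M ↔ x ∈ β ∧ y = g x := by
  simp only [graphOn, mem_sep, pair_mem_prod, pair_inj]
  constructor
  · rintro ⟨-, z, hz, rfl, rfl⟩
    exact ⟨hz, rfl⟩
  · rintro ⟨hx, rfl⟩
    exact ⟨⟨hx, hg x hx⟩, x, hx, rfl, rfl⟩

theorem isFunc_graphOn {g : ZFSet.{0} → ZFSet.{0}} {β : ZFSet.{0}} (hg : ∀ x ∈ β, g x ∈ M) :
    IsFunc β M (graphOn g β M) :=
  ⟨fun _ hz => (mem_sep.1 hz).1, fun x hx =>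
    ⟨g x, (pair_mem_graphOn hg).2 ⟨hx, rfl⟩, fun _ hy => ((pair_mem_graphOn hg).1 hy).2⟩⟩

theorem graphOn_mem {g : ZFSet.{0} → ZFSet.{0}} {β : ZFSet.{0}}
    (hM : IsKappaModelIn Set.univ γ M) (hβ : β ∈ γ) (hg : ∀ x ∈ β, g x ∈ M) :
    graphOn g β M ∈ M :=
  hM.2.2.2.2.1 β hβ _ (Set.mem_univ _) (isFunc_graphOn hg)

theorem notMem_right_of_pair_mem {x f : ZFSet.{0}} : pair x f ∉ f := by
  intro h
  have h1 : rank f < rank ({x, f} : ZFSet) := rank_lt_of_mem (by simp)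
  have h2 : rank ({x, f} : ZFSet) < rank (pair x f) := rank_lt_of_mem (by simp [pair])
  exact lt_irrefl _ (h1.trans (h2.trans (rank_lt_of_mem h)))

theorem zcard_mono {x y : ZFSet.{0}} (h : x ⊆ y) : zcard x ≤ zcard y :=
  Cardinal.mk_le_mk_of_subset h

theorem isCardinalZ_of_kappaModel (hγ : γ.IsOrdinal) (hM : IsKappaModelIn Set.univ γ M) :
    IsCardinalZ γ := by
  refine ⟨hγ, fun β hβ => lt_of_not_ge fun hle => ?_⟩
  have hcard : Cardinal.mk M.toSet ≤ Cardinal.mk β.toSet := hM.2.2.2.1.trans_le hle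
  obtain ⟨e⟩ := hcard
  have hg : ∀ x ∈ β, (if hx : ∃ y : M.toSet, (e y : ZFSet) = x then (hx.choose : ZFSet) else γ) ∈ M := by
    intro x _
    split_ifs with h
    · exact h.choose.2
    · exact hM.2.1
  have hf := graphOn_mem hM hβ hg
  set f := graphOn _ β M with hfdef
  refine notMem_right_of_pair_mem (x := (e ⟨f, hf⟩ : ZFSet)) (f := f) ?_
  refine (pair_mem_graphOn hg).2 ⟨(e ⟨f, hf⟩).2, ?_⟩
  have hx : ∃ y : M.toSet, (e y : ZFSet) = (e ⟨f, hf⟩ : ZFSet) := ⟨_, rfl⟩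
  simp only [dif_pos hx]
  rw [e.injective (Subtype.ext hx.choose_spec)]

theorem aleph0_le_zcard (hM : IsKappaModelIn Set.univ γ M) : Cardinal.aleph0 ≤ zcard γ := by
  by_contra! hlt
  have hsub : insert γ (γ.toSet) ⊆ M.toSet := by
    rintro x (rfl | hx)
    · exact hM.2.1
    · exact hM.2.2.1.mem_trans hx hM.2.1
  have h1 := Cardinal.mk_le_mk_of_subset hsub
  rw [Cardinal.mk_insert (s := γ.toSet) (fun h : γ ∈ γ => mem_irrefl _ h)] at h1
  have h2 : zcard γ + 1 ≤ zcard γ := h1.trans hM.2.2.2.1.le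
  obtain ⟨n, hn⟩ := Cardinal.lt_aleph0.1 hlt
  rw [hn] at h2
  norm_cast at h2
  omega

theorem zcard_eq_lift_card_rank {x : ZFSet.{0}} (hx : x.IsOrdinal) :
    zcard x = Cardinal.lift.{1} x.rank.card := by
  rw [← Ordinal.card_toZFSet, hx.toZFSet_rank_eq]
  exact ZFSet.cardinalMk_coe_sort

theorem rank_eq_ord_card (hγ : IsCardinalZ γ) : γ.rank = γ.rank.card.ord := by
  refine le_antisymm (le_of_not_gt fun hlt => ?_) (Cardinal.ord_card_le _)
  have h := hγ.2 γ.rank.card.ord.toZFSet (by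
    have := Ordinal.toZFSet_mem_toZFSet_iff.2 hlt
    rwa [hγ.1.toZFSet_rank_eq] at this)
  rw [zcard_eq_lift_card_rank (isOrdinal_toZFSet _), zcard_eq_lift_card_rank hγ.1,
    Ordinal.rank_toZFSet, Cardinal.card_ord] at h
  exact lt_irrefl _ h

theorem zsucc_toZFSet (o : Ordinal.{0}) : zsucc o.toZFSet = (o + 1).toZFSet :=
  (Ordinal.toZFSet_add_one o).symm

/-- The ordinal `2 · α`. -/
noncomputable def dbl (α : ZFSet.{0}) : ZFSet.{0} := (2 * α.rank).toZFSet

theorem mem_dbl {α x : ZFSet.{0}} (hα : α.IsOrdinal) :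
    x ∈ dbl α ↔ ∃ β ∈ α, x = dbl β ∨ x = zsucc (dbl β) := by
  rw [dbl, Ordinal.mem_toZFSet_iff]
  constructor
  · rintro ⟨a, ha, rfl⟩
    refine ⟨(a / 2).toZFSet, ?_, ?_⟩
    · rw [← hα.toZFSet_rank_eq, Ordinal.toZFSet_mem_toZFSet_iff]
      exact (Ordinal.lt_mul_iff_div_lt two_ne_zero).1 ha
    · rw [dbl, Ordinal.rank_toZFSet, zsucc_toZFSet]
      have h1 := Ordinal.div_add_mod a 2
      have h2 : a % 2 < 2 := Ordinal.mod_lt a two_ne_zero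
      rw [← one_add_one_eq_two, Order.lt_add_one_iff, Order.le_one_iff] at h2
      rcases h2 with h2 | h2
      · left
        rw [← one_add_one_eq_two] at h1 ⊢
        rw [h2, add_zero] at h1
        rw [h1]
      · right
        rw [← one_add_one_eq_two] at h1 ⊢
        rw [h2] at h1
        rw [h1]
  · rintro ⟨β, hβ, h⟩
    have hlt : β.rank + 1 ≤ α.rank := Order.add_one_le_of_lt (rank_lt_of_mem hβ)
    have hle : 2 * β.rank + 2 ≤ 2 * α.rank := by
      calc 2 * β.rank + 2 = 2 * (β.rank + 1) := by rw [mul_add, mul_one]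
        _ ≤ _ := by gcongr
    have h1 : 2 * β.rank + 1 < 2 * α.rank := lt_of_lt_of_le (by gcongr; exact one_lt_two) hle
    rcases h with rfl | rfl
    · exact ⟨_, (Order.lt_add_one_iff.2 le_rfl).trans h1, rfl⟩
    · exact ⟨_, h1, by rw [dbl, zsucc_toZFSet]⟩

theorem dbl_inj {α β : ZFSet.{0}} (hα : α.IsOrdinal) (hβ : β.IsOrdinal) (h : dbl α = dbl β) :
    α = β := by
  have h1 : 2 * α.rank = 2 * β.rank := Ordinal.toZFSet_injective h
  have h2 := congrArg (· / 2) h1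
  simp only [Ordinal.mul_div_cancel _ (two_ne_zero : (2 : Ordinal) ≠ 0)] at h2
  rwa [IsOrdinal.rank_inj hα hβ] at h2

theorem zsucc_dbl_inj {α β : ZFSet.{0}} (hα : α.IsOrdinal) (hβ : β.IsOrdinal)
    (h : zsucc (dbl α) = zsucc (dbl β)) : α = β := by
  rw [dbl, dbl, zsucc_toZFSet, zsucc_toZFSet] at h
  refine dbl_inj hα hβ ?_
  have := Ordinal.toZFSet_injective h
  rw [← Order.succ_eq_add_one, ← Order.succ_eq_add_one] at this
  rw [dbl, dbl, Order.succ_injective this]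

theorem dbl_ne_zsucc_dbl (α β : ZFSet.{0}) : dbl α ≠ zsucc (dbl β) := by
  rw [dbl, dbl, zsucc_toZFSet]
  intro h
  have h1 := congrArg (· % 2) (Ordinal.toZFSet_injective h)
  simp only [Ordinal.mul_add_mod_self, Ordinal.mul_mod] at h1
  rw [Ordinal.mod_eq_of_lt one_lt_two] at h1
  exact zero_ne_one h1

theorem zsucc_dbl_mem (hγ : IsCardinalZ γ) (hinf : Cardinal.aleph0 ≤ zcard γ) {α : ZFSet.{0}}
    (hα : α ∈ γ) : zsucc (dbl α) ∈ γ := by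
  rw [zcard_eq_lift_card_rank hγ.1, Cardinal.aleph0_le_lift] at hinf
  have hα' := rank_lt_of_mem hα
  rw [← hγ.1.toZFSet_rank_eq, dbl, zsucc_toZFSet, Ordinal.toZFSet_mem_toZFSet_iff]
  rw [rank_eq_ord_card hγ] at hα' ⊢
  have hlim := Cardinal.isSuccLimit_ord hinf
  have h2 : (2 : Ordinal) < γ.rank.card.ord :=
    (Ordinal.natCast_lt_omega0 2).trans_le (Cardinal.omega0_le_ord.2 hinf)
  exact hlim.add_one_lt (Ordinal.isPrincipal_mul_ord hinf h2 hα')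

theorem dbl_mem (hγ : IsCardinalZ γ) (hinf : Cardinal.aleph0 ≤ zcard γ) {α : ZFSet.{0}}
    (hα : α ∈ γ) : dbl α ∈ γ :=
  hγ.1.mem_trans (mem_insert _ _) (zsucc_dbl_mem hγ hinf hα)

theorem zsucc_mem (hγ : IsCardinalZ γ) (hinf : Cardinal.aleph0 ≤ zcard γ) {α : ZFSet.{0}}
    (hα : α ∈ γ) : zsucc α ∈ γ := by
  rw [zcard_eq_lift_card_rank hγ.1, Cardinal.aleph0_le_lift] at hinf
  have hlt := rank_lt_of_mem hα
  rw [← (hγ.1.mem hα).toZFSet_rank_eq, zsucc_toZFSet]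
  rw [← hγ.1.toZFSet_rank_eq, Ordinal.toZFSet_mem_toZFSet_iff]
  rw [rank_eq_ord_card hγ] at hlt ⊢
  exact (Cardinal.isSuccLimit_ord hinf).add_one_lt hlt

/-- `h` is (the graph of) an initial segment of the function `dbl`, as expressed by a
bounded formula. -/
def IsDblApprox (h : ZFSet.{0}) : Prop :=
  ∀ α δ, pair α δ ∈ h →
    (∀ β ∈ α, ∃ ε ∈ δ, pair β ε ∈ h ∧ ∃ s ∈ δ, s = zsucc ε) ∧
    ∀ x ∈ δ, ∃ β ∈ α, ∃ ε ∈ δ, pair β ε ∈ h ∧ (x = ε ∨ x = zsucc ε)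

theorem IsDblApprox.eq_dbl {h : ZFSet.{0}} (hh : IsDblApprox h) {α : ZFSet.{0}} :
    α.IsOrdinal → ∀ {δ}, pair α δ ∈ h → δ = dbl α := by
  induction α using ZFSet.inductionOn with
  | _ α ih =>
    intro hα δ hδ
    obtain ⟨h1, h2⟩ := hh α δ hδ
    ext x
    rw [mem_dbl hα]
    constructor
    · intro hx
      obtain ⟨β, hβ, ε, -, hε, hxε⟩ := h2 x hx
      rw [ih β hβ (hα.mem hβ) hε] at hxε
      exact ⟨β, hβ, hxε⟩
    · rintro ⟨β, hβ, hx⟩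
      obtain ⟨ε, hεδ, hε, s, hs, rfl⟩ := h1 β hβ
      rw [← ih β hβ (hα.mem hβ) hε] at hx
      rcases hx with rfl | rfl <;> assumption

theorem isDblApprox_graphOn {β : ZFSet.{0}} (hβ : β.IsOrdinal) (hg : ∀ x ∈ β, dbl x ∈ M) :
    IsDblApprox (graphOn dbl β M) := by
  intro α δ h
  obtain ⟨hα, rfl⟩ := (pair_mem_graphOn hg).1 h
  have hαo := hβ.mem hα
  constructor
  · intro ξ hξ
    exact ⟨dbl ξ, (mem_dbl hαo).2 ⟨ξ, hξ, Or.inl rfl⟩,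
      (pair_mem_graphOn hg).2 ⟨hβ.mem_trans hξ hα, rfl⟩, _,
      (mem_dbl hαo).2 ⟨ξ, hξ, Or.inr rfl⟩, rfl⟩
  · intro x hx
    obtain ⟨ξ, hξ, h⟩ := (mem_dbl hαo).1 hx
    exact ⟨ξ, hξ, dbl ξ, (mem_dbl hαo).2 ⟨ξ, hξ, Or.inl rfl⟩,
      (pair_mem_graphOn hg).2 ⟨hβ.mem_trans hξ hα, rfl⟩, h⟩

theorem isDefinablePred_isDblApprox {n : ℕ} (i : Fin n) :
    IsDefinablePred (fun _ v => IsDblApprox (v i)) := by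
  have h : IsDefinablePred (fun M (v : Fin n → ZFSet.{0}) =>
      ∀ α ∈ M, ∀ δ ∈ M, pair α δ ∈ v i →
        (∀ β ∈ α, ∃ ε ∈ δ, pair β ε ∈ v i ∧ ∃ s ∈ δ, s = zsucc ε) ∧
        ∀ x ∈ δ, ∃ β ∈ α, ∃ ε ∈ δ, pair β ε ∈ v i ∧ (x = ε ∨ x = zsucc ε)) := by
    refine .all (.all (.imp (.pair_mem _ _ _) (.and ?_ ?_)))
    · exact .ball _ (.bex _ (.and (.pair_mem _ _ _) (.bex _ (.eq_zsucc _ _))))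
    · exact .ball _ (.bex _ (.bex _ (.and (.pair_mem _ _ _) (.or (.eq _ _) (.eq_zsucc _ _)))))
  refine h.congr fun M hM v hv => ⟨fun H α δ hp => ?_, fun H α _ δ _ => H α δ⟩
  have hpair : ({α, δ} : ZFSet) ∈ M :=
    hM.mem_trans (y := pair α δ) (by simp [pair]) (hM.mem_trans hp (hv i))
  exact H α (hM.mem_trans (by simp) hpair) δ (hM.mem_trans (by simp) hpair) hp

/-- `δ = 2 · α`, as computed in the transitive set `M`. -/
def DblIn (M α δ : ZFSet.{0}) : Prop := ∃ h ∈ M, IsDblApprox h ∧ pair α δ ∈ h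

theorem isDefinablePred_dblIn {n : ℕ} (i j : Fin n) :
    IsDefinablePred (fun M v => DblIn M (v i) (v j)) :=
  .ex (.and (isDefinablePred_isDblApprox _) (.pair_mem _ _ _))

theorem dblIn_iff (hγ : IsCardinalZ γ) (hM : IsKappaModelIn Set.univ γ M)
    {α δ : ZFSet.{0}} (hα : α ∈ γ) : DblIn M α δ ↔ δ = dbl α := by
  have hinf := aleph0_le_zcard hM
  constructor
  · rintro ⟨h, -, hh, hp⟩
    exact hh.eq_dbl (hγ.1.mem hα) hp
  · rintro rfl
    have hs := zsucc_mem hγ hinf hα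
    have hg : ∀ x ∈ zsucc α, dbl x ∈ M := fun x hx =>
      hM.2.2.1.mem_trans (dbl_mem hγ hinf (hγ.1.mem_trans hx hs)) hM.2.1
    exact ⟨graphOn dbl (zsucc α) M, graphOn_mem hM hs hg, isDblApprox_graphOn (hγ.1.mem hs) hg,
      (pair_mem_graphOn hg).2 ⟨mem_insert _ _, rfl⟩⟩

/-- Two subsets of an infinite cardinal can be coded by one, decodable in every model. -/
theorem exists_code (hγ : IsCardinalZ γ) {A Y : ZFSet.{0}} (hA : A ⊆ γ) (hY : Y ⊆ γ) :
    ∃ B ⊆ γ, ∀ M, IsKappaModelIn Set.univ γ M → B ∈ M → A ∈ M ∧ Y ∈ M := by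
  refine ⟨ZFSet.sep (fun x => (∃ α ∈ A, x = dbl α) ∨ ∃ α ∈ Y, x = zsucc (dbl α)) γ,
    fun x hx => (mem_sep.1 hx).1, fun M hM hB => ?_⟩
  have hinf := aleph0_le_zcard hM
  set B := ZFSet.sep (fun x => (∃ α ∈ A, x = dbl α) ∨ ∃ α ∈ Y, x = zsucc (dbl α)) γ with hBdef
  have hγM : ∀ x ∈ γ, x ∈ M := fun x hx => hM.2.2.1.mem_trans hx hM.2.1
  constructor
  · have hP : IsDefinablePred (fun M (v : Fin 3 → ZFSet.{0}) =>
        ∃ δ ∈ M, DblIn M (v 2) δ ∧ δ ∈ v 0) :=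
      .ex (.and (isDefinablePred_dblIn _ _) (.mem _ _))
    obtain ⟨c, hc, hcx⟩ := hP.exists_sep hM.2.2.1 hM.2.2.2.2.2 hM.2.1 hB
    suffices A = c from this ▸ hc
    ext x
    rw [hcx]
    change x ∈ A ↔ x ∈ γ ∧ ∃ δ ∈ M, DblIn M x δ ∧ δ ∈ B
    constructor
    · intro hx
      have hxγ := hA hx
      have hd := dbl_mem hγ hinf hxγ
      exact ⟨hxγ, dbl x, hγM _ hd, (dblIn_iff hγ hM hxγ).2 rfl,
        mem_sep.2 ⟨hd, Or.inl ⟨x, hx, rfl⟩⟩⟩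
    · rintro ⟨hxγ, δ, -, hδ, hδB⟩
      rw [dblIn_iff hγ hM hxγ] at hδ
      subst hδ
      rcases (mem_sep.1 hδB).2 with ⟨α, hα, h⟩ | ⟨α, hα, h⟩
      · rwa [dbl_inj (hγ.1.mem hxγ) (hγ.1.mem (hA hα)) h]
      · exact absurd h (dbl_ne_zsucc_dbl _ _)
  · have hP : IsDefinablePred (fun M (v : Fin 3 → ZFSet.{0}) =>
        ∃ δ ∈ M, DblIn M (v 2) δ ∧ ∃ s ∈ v 0, s = zsucc δ) :=
      .ex (.and (isDefinablePred_dblIn _ _) (.bex _ (.eq_zsucc _ _)))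
    obtain ⟨c, hc, hcx⟩ := hP.exists_sep hM.2.2.1 hM.2.2.2.2.2 hM.2.1 hB
    suffices Y = c from this ▸ hc
    ext x
    rw [hcx]
    change x ∈ Y ↔ x ∈ γ ∧ ∃ δ ∈ M, DblIn M x δ ∧ ∃ s ∈ B, s = zsucc δ
    constructor
    · intro hx
      have hxγ := hY hx
      exact ⟨hxγ, dbl x, hγM _ (dbl_mem hγ hinf hxγ), (dblIn_iff hγ hM hxγ).2 rfl, _,
        mem_sep.2 ⟨zsucc_dbl_mem hγ hinf hxγ, Or.inr ⟨x, hx, rfl⟩⟩, rfl⟩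
    · rintro ⟨hxγ, δ, -, hδ, s, hsB, rfl⟩
      rw [dblIn_iff hγ hM hxγ] at hδ
      subst hδ
      rcases (mem_sep.1 hsB).2 with ⟨α, hα, h⟩ | ⟨α, hα, h⟩
      · exact absurd h.symm (dbl_ne_zsucc_dbl _ _)
      · rwa [zsucc_dbl_inj (hγ.1.mem hxγ) (hγ.1.mem (hY hα)) h]

end

section

variable {γ κ X Y : ZFSet.{0}}

namespace IsWeaklyCompactIn

theorem isCardinalZ (h : IsWeaklyCompactIn Set.univ γ X) (hγ : γ.IsOrdinal) : IsCardinalZ γ := by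
  obtain ⟨M, N, j, hM, -⟩ := h.2 ∅ (Set.mem_univ _) (empty_subset _)
  exact isCardinalZ_of_kappaModel hγ hM

theorem aleph0_le (h : IsWeaklyCompactIn Set.univ γ X) : Cardinal.aleph0 ≤ zcard γ := by
  obtain ⟨M, N, j, hM, -⟩ := h.2 ∅ (Set.mem_univ _) (empty_subset _)
  exact aleph0_le_zcard hM

theorem exists_mem (h : IsWeaklyCompactIn Set.univ γ X) : ∃ β, β ∈ γ := by
  by_contra! hempty
  have h0 : zcard γ = 0 := Cardinal.mk_eq_zero_iff.2 ⟨fun x => hempty x x.2⟩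
  exact absurd h.aleph0_le (h0 ▸ not_le.2 Cardinal.aleph0_pos)

theorem mono (h : IsWeaklyCompactIn Set.univ γ X) (hγ : γ.IsOrdinal) (hXY : X ⊆ Y)
    (hY : Y ⊆ γ) : IsWeaklyCompactIn Set.univ γ Y := by
  refine ⟨hY, fun A _ hA => ?_⟩
  obtain ⟨B, hB, hdec⟩ := exists_code (h.isCardinalZ hγ) hA hY
  obtain ⟨M, N, j, hM, hN, hBM, hXM, hj, hcrit, hmem⟩ := h.2 B (Set.mem_univ _) hB
  obtain ⟨hAM, hYM⟩ := hdec M hM hBM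
  refine ⟨M, N, j, hM, hN, hAM, hYM, hj, hcrit, ?_⟩
  have hP : IsDefinablePred (fun _ (v : Fin 2 → ZFSet.{0}) => ∀ x ∈ v 0, x ∈ v 1) :=
    .ball _ (.mem _ _)
  have hv : ∀ i, ![X, Y] i ∈ M := by
    intro i; fin_cases i <;> assumption
  exact (hP.elem hM.2.2.1 hN.2.2.1 hj hv).1 (fun x hx => hXY hx) γ hmem

theorem exists_mem_gt (h : IsWeaklyCompactIn Set.univ γ X) {β : ZFSet.{0}} (hβ : β ∈ γ) :
    ∃ δ ∈ X, β ∈ δ := by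
  obtain ⟨M, N, j, hM, hN, -, hXM, hj, hcrit, hmem⟩ :=
    h.2 ∅ (Set.mem_univ _) (empty_subset _)
  have hP : IsDefinablePred (fun _ (v : Fin 2 → ZFSet.{0}) => ∃ d ∈ v 0, v 1 ∈ d) :=
    .bex _ (.mem _ _)
  have hv : ∀ i, ![X, β] i ∈ M := by
    intro i; fin_cases i
    · exact hXM
    · exact hM.2.2.1.mem_trans hβ hM.2.1
  refine (hP.elem hM.2.2.1 hN.2.2.1 hj hv).2 ⟨γ, hmem, ?_⟩
  change j β ∈ γ
  rwa [hcrit.1 β hβ]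

theorem isRegularIn (h : IsWeaklyCompactIn Set.univ γ X) (hγ : γ.IsOrdinal) :
    IsRegularIn Set.univ γ := by
  refine ⟨h.isCardinalZ hγ, fun β hβ f _ hf => ?_⟩
  by_contra! hunb
  obtain ⟨M, N, j, hM, hN, -, -, hj, hcrit, -⟩ := h.2 ∅ (Set.mem_univ _) (empty_subset _)
  have hγM : ∀ x ∈ γ, x ∈ M := fun x hx => hM.2.2.1.mem_trans hx hM.2.1
  have hfM : f ∈ M := by
    refine hM.2.2.2.2.1 β hβ f (Set.mem_univ _) ⟨fun z hz => ?_, hf.2⟩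
    obtain ⟨a, ha, b, hb, rfl⟩ := mem_prod.1 (hf.1 hz)
    exact pair_mem_prod.2 ⟨ha, hγM b hb⟩
  have hv : ∀ i, ![γ, β, f] i ∈ M := by
    intro i; fin_cases i
    · exact hM.2.1
    · exact hγM β hβ
    · exact hfM
  have hP : IsDefinablePred (fun M (v : Fin 3 → ZFSet.{0}) =>
      ∀ δ ∈ v 0, ∃ ξ ∈ v 1, ∃ y ∈ M, pair ξ y ∈ v 2 ∧ ¬ y ∈ δ) :=
    .ball _ (.bex _ (.ex (.and (.pair_mem _ _ _) (.not (.mem _ _)))))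
  have hQ : IsDefinablePred (fun M (v : Fin 3 → ZFSet.{0}) =>
      ∀ ξ ∈ v 1, ∀ y ∈ M, ∀ z ∈ M, pair ξ y ∈ v 2 → pair ξ z ∈ v 2 → y = z) :=
    .ball _ (.all (.all (.imp (.pair_mem _ _ _) (.imp (.pair_mem _ _ _) (.eq _ _)))))
  have hPN := (hP.elem hM.2.2.1 hN.2.2.1 hj hv).1 (by
    intro δ hδ
    obtain ⟨ξ, hξ, y, hy, hyδ⟩ := hunb δ hδ
    exact ⟨ξ, hξ, y, hγM y (pair_mem_prod.1 (hf.1 hy)).2, hy, hyδ⟩)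
  have hQN := (hQ.elem hM.2.2.1 hN.2.2.1 hj hv).1 (by
    intro ξ hξ y _ z _ hy hz
    exact (hf.2 ξ hξ).unique hy hz)
  obtain ⟨ξ, hξ, y, hyN, hy, hyγ⟩ := hPN γ hcrit.2
  have hξβ : ξ ∈ β := by rw [← hcrit.1 β hβ]; exact hξ
  obtain ⟨z, hz, -⟩ := hf.2 ξ hξβ
  have hzγ : z ∈ γ := (pair_mem_prod.1 (hf.1 hz)).2
  have hv' : ∀ i, ![ξ, z, f] i ∈ M := by
    intro i; fin_cases i
    · exact hγM ξ (hγ.mem_trans hξβ hβ)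
    · exact hγM z hzγ
    · exact hfM
  have hz' := ((IsDefinablePred.pair_mem 0 1 2).elem hM.2.2.1 hN.2.2.1 hj hv').1 hz
  change pair (j ξ) (j z) ∈ j f at hz'
  rw [hcrit.1 ξ (hγ.mem_trans hξβ hβ), hcrit.1 z hzγ] at hz'
  have hzN : z ∈ N := hN.2.2.1.mem_trans hzγ hN.2.1
  exact hyγ (hQN ξ hξ y hyN z hzN hy hz' ▸ hzγ)

/-- The powerset of an ordinal below `γ` injects into any `γ`-model. -/
theorem zcard_powerset_le (h : IsWeaklyCompactIn Set.univ γ X) {β : ZFSet.{0}} (hβ : β ∈ γ) :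
    zcard (powerset β) ≤ zcard γ := by
  obtain ⟨M, N, j, hM, -⟩ := h.2 ∅ (Set.mem_univ _) (empty_subset _)
  have hg : ∀ a : ZFSet.{0}, ∀ x ∈ β, (if x ∈ a then β else γ) ∈ M := by
    intro a x _
    split_ifs
    · exact hM.2.2.1.mem_trans hβ hM.2.1
    · exact hM.2.1
  have hne : β ≠ γ := fun e => mem_irrefl γ (e ▸ hβ)
  rw [← hM.2.2.2.1]
  refine Cardinal.mk_le_of_injective
    (f := fun a : (powerset β).toSet => (⟨_, graphOn_mem hM hβ (hg a)⟩ : M.toSet)) ?_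
  have key : ∀ a b : ZFSet.{0}, a ⊆ β →
      graphOn (fun x => if x ∈ a then β else γ) β M =
        graphOn (fun x => if x ∈ b then β else γ) β M → a ⊆ b := by
    intro a b ha hab x hx
    have h1 : pair x β ∈ graphOn (fun x => if x ∈ a then β else γ) β M :=
      (pair_mem_graphOn (hg a)).2 ⟨ha hx, by simp [hx]⟩
    rw [hab, pair_mem_graphOn (hg b)] at h1
    by_contra hxb
    exact hne (by simpa [hxb] using h1.2)
  rintro ⟨a, ha⟩ ⟨b, hb⟩ hab
  have hab' := congrArg Subtype.val hab
  exact Subtype.ext (subset_antisymm (key a b (mem_powerset.1 ha) hab')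
    (key b a (mem_powerset.1 hb) hab'.symm))

end IsWeaklyCompactIn

theorem mk_ofNat (n : ℕ) : ZFSet.mk (PSet.ofNat n) = (n : Ordinal.{0}).toZFSet := by
  induction n with
  | zero => simp [PSet.ofNat]; rfl
  | succ n ih =>
    rw [Nat.cast_add_one, Ordinal.toZFSet_add_one, ← ih]
    rfl

theorem omega_eq_toZFSet : ZFSet.omega.{0} = Ordinal.omega0.toZFSet := by
  ext x
  rw [Ordinal.mem_toZFSet_iff]
  constructor
  · induction x using Quotient.inductionOn with
    | _ x =>
      rintro ⟨⟨n⟩, hn⟩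
      exact ⟨n, Ordinal.natCast_lt_omega0 n, by
        rw [← mk_ofNat]; exact (Quotient.sound hn).symm⟩
  · rintro ⟨a, ha, rfl⟩
    obtain ⟨n, rfl⟩ := Ordinal.lt_omega0.1 ha
    rw [← mk_ofNat]
    exact ⟨⟨n⟩, PSet.Equiv.refl _⟩

theorem zcard_omega : zcard ZFSet.omega.{0} = Cardinal.aleph0 := by
  rw [omega_eq_toZFSet, zcard_eq_lift_card_rank (isOrdinal_toZFSet _), Ordinal.rank_toZFSet]
  simp

theorem mk_le_of_isFunc_injective {a b f : ZFSet.{0}} (hf : IsFunc a b f)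
    (hinj : ∀ x x' y, pair x y ∈ f → pair x' y ∈ f → x = x') : zcard a ≤ zcard b := by
  have hex : ∀ x : a.toSet, ∃ y : b.toSet, pair (x : ZFSet) y ∈ f := fun x => by
    obtain ⟨y, hy, -⟩ := hf.2 x x.2
    exact ⟨⟨y, (pair_mem_prod.1 (hf.1 hy)).2⟩, hy⟩
  choose g hg using hex
  refine Cardinal.mk_le_of_injective (f := g) fun x x' h => ?_
  exact Subtype.ext (hinj _ _ _ (hg x) (h ▸ hg x'))

theorem iterWcTraceIn_subset (κ : ZFSet.{0}) (n : ℕ) : iterWcTraceIn Set.univ κ n κ ⊆ κ := by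
  cases n with
  | zero => exact fun _ h => h
  | succ n =>
    rw [iterWcTraceIn, wcTraceIn]
    exact sep_subset

theorem iterWcTraceIn_inter (n : ℕ) : ∀ {κ γ : ZFSet.{0}}, κ.IsOrdinal → γ ∈ κ →
    iterWcTraceIn Set.univ κ n κ ∩ γ = iterWcTraceIn Set.univ γ n γ := by
  induction n with
  | zero =>
    intro κ γ hκ hγ
    ext x
    exact mem_inter.trans ⟨fun h => h.2, fun h => ⟨hκ.mem_trans h hγ, h⟩⟩
  | succ n ih =>
    intro κ γ hκ hγ
    ext x
    simp only [iterWcTraceIn, wcTraceIn, mem_inter, mem_sep]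
    constructor
    · rintro ⟨⟨hxκ, hx⟩, hxγ⟩
      rw [ih hκ hxκ] at hx
      exact ⟨hxγ, by rwa [ih (hκ.mem hγ) hxγ]⟩
    · rintro ⟨hxγ, hx⟩
      have hxκ := hκ.mem_trans hxγ hγ
      rw [ih (hκ.mem hγ) hxγ] at hx
      exact ⟨⟨hxκ, by rwa [ih hκ hxκ]⟩, hxγ⟩

theorem mem_iterWcTraceIn_succ (hκ : κ.IsOrdinal) {n : ℕ} :
    γ ∈ iterWcTraceIn Set.univ κ (n + 1) κ ↔
      γ ∈ κ ∧ IsWeaklyCompactIn Set.univ γ (iterWcTraceIn Set.univ γ n γ) := by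
  simp only [iterWcTraceIn, wcTraceIn, mem_sep]
  exact and_congr_right fun h => by rw [iterWcTraceIn_inter n hκ h]

theorem iterWcTraceIn_succ_subset (n : ℕ) : ∀ {κ : ZFSet.{0}}, κ.IsOrdinal →
    iterWcTraceIn Set.univ κ (n + 1) κ ⊆ iterWcTraceIn Set.univ κ n κ := by
  induction n with
  | zero => exact fun _ => iterWcTraceIn_subset _ 1
  | succ n ih =>
    intro κ hκ γ hγ
    rw [mem_iterWcTraceIn_succ hκ] at hγ ⊢
    have hγo := hκ.mem hγ.1
    exact ⟨hγ.1, hγ.2.mono hγo (ih hγo) (iterWcTraceIn_subset _ _)⟩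

theorem iterWcTraceIn_antitone (hκ : κ.IsOrdinal) {m n : ℕ} (h : m ≤ n) :
    iterWcTraceIn Set.univ κ n κ ⊆ iterWcTraceIn Set.univ κ m κ := by
  induction h with
  | refl => exact fun _ h => h
  | step _ ih => exact fun _ hx => ih (iterWcTraceIn_succ_subset _ hκ hx)

theorem ssetIn_succ (hκ : κ.IsOrdinal) (n : ℕ) :
    SsetIn Set.univ κ (n + 1) = iterWcTraceIn Set.univ κ (n + 1) κ := by
  ext γ
  rw [mem_iterWcTraceIn_succ hκ]
  simp only [SsetIn, mem_sep]
  refine and_congr_right fun hγ => ⟨fun h => h n (Nat.lt_succ_self n), fun h m hm => ?_⟩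
  have hγo := hκ.mem hγ
  exact h.mono hγo (iterWcTraceIn_antitone hγo (Nat.le_of_lt_succ hm)) (iterWcTraceIn_subset _ _)

theorem isInaccessibleIn_of_trace (hγ : γ.IsOrdinal)
    (h : IsWeaklyCompactIn Set.univ γ (iterWcTraceIn Set.univ γ 1 γ)) :
    IsInaccessibleIn Set.univ γ := by
  have hcard := h.isCardinalZ hγ
  have hlt : ∀ β ∈ γ, ∃ δ ∈ γ, β ∈ δ ∧ IsWeaklyCompactIn Set.univ δ δ := fun β hβ => by
    obtain ⟨δ, hδ, hβδ⟩ := h.exists_mem_gt hβ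
    obtain ⟨hδγ, hwc⟩ := (mem_iterWcTraceIn_succ hγ).1 hδ
    exact ⟨δ, hδγ, hβδ, hwc⟩
  refine ⟨h.isRegularIn hγ, ?_, ?_⟩
  · obtain ⟨β, hβ⟩ := h.exists_mem
    obtain ⟨δ, hδ, -, hwc⟩ := hlt β hβ
    have hω : ZFSet.omega.{0}.IsOrdinal := omega_eq_toZFSet ▸ isOrdinal_toZFSet _
    by_contra hnot
    have hle := zcard_mono ((hω.notMem_iff_subset hγ).1 hnot)
    rw [zcard_omega] at hle
    exact absurd (hwc.aleph0_le.trans_lt (hcard.2 δ hδ)) (not_lt.2 hle)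
  · rintro β hβ ⟨f, -, hf, hinj⟩
    obtain ⟨δ, hδ, hβδ, hwc⟩ := hlt β hβ
    exact absurd (hcard.2 δ hδ)
      (not_lt.2 ((mk_le_of_isFunc_injective hf hinj).trans (hwc.zcard_powerset_le hβδ)))

theorem IsWeaklyCompactIn.isStationaryIn (h : IsWeaklyCompactIn Set.univ γ X)
    (hγ : γ.IsOrdinal) : IsStationaryIn Set.univ X γ := by
  rintro C - ⟨hCγ, hunb, hclosed⟩
  obtain ⟨M, N, j, hM, hN, hCM, hXM, hj, hcrit, hmem⟩ := h.2 C (Set.mem_univ _) hCγ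
  have hv : ∀ i, ![C, γ] i ∈ M := by
    intro i; fin_cases i
    · exact hCM
    · exact hM.2.1
  have hP : IsDefinablePred (fun _ (v : Fin 2 → ZFSet.{0}) =>
      ∀ β ∈ v 1, (∃ ξ ∈ β, ξ = ξ) → (∀ ξ ∈ β, ∃ η ∈ v 0, η ∈ β ∧ ξ ∈ η) → β ∈ v 0) :=
    .ball _ (.imp (.bex _ (.eq _ _))
      (.imp (.ball _ (.bex _ (.and (.mem _ _) (.mem _ _)))) (.mem _ _)))
  have hPN := (hP.elem hM.2.2.1 hN.2.2.1 hj hv).1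
    (fun β hβ ⟨ξ, hξ, _⟩ H => hclosed β hβ ⟨ξ, hξ⟩ H) γ hcrit.2
  have hγC : γ ∈ j C := by
    have hsucc : ∀ ξ ∈ γ, ∃ η ∈ C, ξ ∈ η := fun ξ hξ => by
      have hs := zsucc_mem (h.isCardinalZ hγ) h.aleph0_le hξ
      obtain ⟨η, hη, hlt | rfl⟩ := hunb _ hs
      · exact ⟨η, hη, (hγ.mem (hCγ hη)).mem_trans (mem_insert _ _) hlt⟩
      · exact ⟨_, hη, mem_insert _ _⟩
    refine hPN ?_ ?_
    · obtain ⟨β, hβ⟩ := h.exists_mem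
      exact ⟨β, hβ, rfl⟩
    · intro ξ hξ
      obtain ⟨η, hη, hlt⟩ := hsucc ξ hξ
      have hv' : ∀ i, ![η, C] i ∈ M := by
        intro i; fin_cases i
        · exact hM.2.2.1.mem_trans (hCγ hη) hM.2.1
        · exact hCM
      have hη' := ((IsDefinablePred.mem 0 1).elem hM.2.2.1 hN.2.2.1 hj hv').1 hη
      change j η ∈ j C at hη'
      rw [hcrit.1 η (hCγ hη)] at hη'
      exact ⟨η, hη', hCγ hη, hlt⟩
  have hQ : IsDefinablePred (fun _ (v : Fin 2 → ZFSet.{0}) => ∃ x ∈ v 0, x ∈ v 1) :=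
    .bex _ (.mem _ _)
  have hv' : ∀ i, ![X, C] i ∈ M := by
    intro i; fin_cases i <;> assumption
  exact (hQ.elem hM.2.2.1 hN.2.2.1 hj hv').2 ⟨γ, hmem, hγC⟩

theorem isMahloIn_of_trace (hγ : γ.IsOrdinal)
    (h : IsWeaklyCompactIn Set.univ γ (iterWcTraceIn Set.univ γ 2 γ)) :
    IsMahloIn Set.univ γ := by
  refine ⟨isInaccessibleIn_of_trace hγ
    (h.mono hγ (iterWcTraceIn_succ_subset 1 hγ) (iterWcTraceIn_subset _ _)), fun C hC hclub => ?_⟩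
  obtain ⟨x, hx, hxC⟩ := h.isStationaryIn hγ C hC hclub
  obtain ⟨hxγ, hwc⟩ := (mem_iterWcTraceIn_succ hγ).1 hx
  exact ⟨x, mem_sep.2 ⟨hxγ, isInaccessibleIn_of_trace (hγ.mem hxγ) hwc⟩, hxC⟩

end

/-- A weakly compact cardinal `κ` is `ω`-weakly compact iff for every
`n < ω` the set `S^κ_n` (Mahlo cardinals below `κ` for `n = 0`, `n`-weakly compact cardinals
below `κ` for `n > 0`) is a weakly compact subset of `κ`. -/
theorem omega_weakly_compact_iff_Ssets_weakly_compact (κ : ZFSet)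
    (hκ : IsWCCardinal κ) :
    IsOmegaWeaklyCompactIn Set.univ κ ↔
      ∀ n : ℕ, IsWeaklyCompactSubset κ (SsetIn Set.univ κ n) := by
  have hκo := hκ.1.1
  constructor
  · rintro h (_ | n)
    · refine (h 3).mono hκo (fun γ hγ => ?_) fun γ hγ => (mem_sep.1 hγ).1
      obtain ⟨hγκ, hwc⟩ := (mem_iterWcTraceIn_succ hκo).1 hγ
      exact mem_sep.2 ⟨hγκ, isMahloIn_of_trace (hκo.mem hγκ) hwc⟩
    · rw [ssetIn_succ hκo]
      exact h (n + 1)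
  · rintro h (_ | n)
    · exact hκ.2.2
    · rw [← ssetIn_succ hκo]
      exact h (n + 1)
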